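/- arXiv:1304.4813 — 2 statements merged into one kernel-verified Lean document; each statement's English description precedes it below -/
import Mathlib

section
/- For every integer n ≥ 1 one has the identity (in ℚ): Σ_{π ∈ Π_n} ov(π) = (1/4)·B_{n+2} + (3/4)·B_{n+1} − (n + 5/4)·B_n − (n/2)·B_{n−1}. Equivalently, the average number of overlappings in a random set partition of [n] equals this quantity divided by B_n. -/
open scoped Classical

def seg (n : ℕ) : Finset ℕ := Finset.Icc 1 n

def IsPartition (P : Finset (Finset ℕ)) (S : Finset ℕ) : Prop :=
  ∅ ∉ P ∧ (∀ B ∈ P, ∀ C ∈ P, B ≠ C → Disjoint B C) ∧ P.biUnion id = S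

noncomputable def partitions (n : ℕ) : Finset (Finset (Finset ℕ)) :=
  ((seg n).powerset.powerset).filter fun P => IsPartition P (seg n)

noncomputable def partitionsK (n k : ℕ) : Finset (Finset (Finset ℕ)) :=
  (partitions n).filter fun P => P.card = k

noncomputable def bell (n : ℕ) : ℕ := (partitions n).card

noncomputable def stirling (n k : ℕ) : ℕ := (partitionsK n k).card

/-- `(i, j)` is an edge of the set partition `P`. -/
def IsEdge (P : Finset (Finset ℕ)) (i j : ℕ) : Prop :=
  i < j ∧ ∃ B ∈ P, i ∈ B ∧ j ∈ B ∧ ∀ p ∈ B, ¬(i < p ∧ p < j)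

/-- `crol P`: number of linear crossings. -/
noncomputable def crol (P : Finset (Finset ℕ)) : ℕ :=
  Nat.card {e : (ℕ × ℕ) × ℕ × ℕ //
    IsEdge P e.1.1 e.1.2 ∧ IsEdge P e.2.1 e.2.2 ∧
      e.1.1 < e.2.1 ∧ e.2.1 < e.1.2 ∧ e.1.2 < e.2.2}

/-- `(i, j)` is a circular edge of `P`. -/
def IsCircEdge (P : Finset (Finset ℕ)) (i j : ℕ) : Prop :=
  IsEdge P i j ∨
    ∃ B ∈ P, ∃ h : B.Nonempty, 2 ≤ B.card ∧ i = B.min' h ∧ j = B.max' h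

/-- `croc P`: number of circular crossings. -/
noncomputable def croc (P : Finset (Finset ℕ)) : ℕ :=
  Nat.card {e : (ℕ × ℕ) × ℕ × ℕ //
    IsCircEdge P e.1.1 e.1.2 ∧ IsCircEdge P e.2.1 e.2.2 ∧
      e.1.1 < e.2.1 ∧ e.2.1 < e.1.2 ∧ e.1.2 < e.2.2}

/-- Two blocks overlap: `min B < min B' < max B < max B'`. -/
def Overlap (B B' : Finset ℕ) : Prop :=
  ∃ (h : B.Nonempty) (h' : B'.Nonempty),
    B.min' h < B'.min' h' ∧ B'.min' h' < B.max' h ∧ B.max' h < B'.max' h'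

/-- `ov P`: number of (unordered) pairs of blocks of `P` that overlap. -/
noncomputable def ov (P : Finset (Finset ℕ)) : ℕ :=
  Nat.card {p : Finset ℕ × Finset ℕ // p.1 ∈ P ∧ p.2 ∈ P ∧ Overlap p.1 p.2}

/-- Two blocks embrace: `min B < min B' ≤ max B' < max B`. -/
def Embrace (B B' : Finset ℕ) : Prop :=
  ∃ (h : B.Nonempty) (h' : B'.Nonempty),
    B.min' h < B'.min' h' ∧ B'.min' h' ≤ B'.max' h' ∧ B'.max' h' < B.max' h

noncomputable def emb (P : Finset (Finset ℕ)) : ℕ :=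
  Nat.card {p : Finset ℕ × Finset ℕ // p.1 ∈ P ∧ p.2 ∈ P ∧ Embrace p.1 p.2}

/-- The block of `P` containing `i`. -/
noncomputable def blockOf (P : Finset (Finset ℕ)) (i : ℕ) : Finset ℕ :=
  (P.filter fun B => i ∈ B).biUnion id

/-- The restricted growth function of `P`: `rgf P i = j` iff `i` lies in the `j`-th
block of `P`, the blocks being ordered by increasing minima. -/
noncomputable def rgf (P : Finset (Finset ℕ)) (i : ℕ) : ℕ :=
  (P.filter fun B => B.min ≤ (blockOf P i).min).card

/-- A 2-pattern: a word on `{1,2}` containing both letters. -/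
def TwoPattern {r : ℕ} (σ : Fin r → ℕ) : Prop :=
  (∀ t, σ t = 1 ∨ σ t = 2) ∧ (∃ t, σ t = 1) ∧ (∃ t, σ t = 2)

/-- `occ n σ P`: number of occurrences of the 2-pattern `σ` in the partition `P` of `[n]`. -/
noncomputable def occ (n : ℕ) {r : ℕ} (σ : Fin r → ℕ) (P : Finset (Finset ℕ)) : ℕ :=
  Nat.card {i : Fin r → ℕ // StrictMono i ∧ (∀ t, i t ∈ seg n) ∧
    ∃ a b : ℕ, a < b ∧
      ∀ t, (σ t = 1 → rgf P (i t) = a) ∧ (σ t = 2 → rgf P (i t) = b)}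

/-- Carlitz `q`-Stirling polynomials. -/
noncomputable def qS : ℕ → ℕ → Polynomial ℚ
  | 0, 0 => 1
  | 0, _ + 1 => 0
  | _ + 1, 0 => 0
  | n + 1, k + 1 =>
      Polynomial.X ^ k * qS n k +
        (∑ i ∈ Finset.range (k + 1), Polynomial.X ^ i) * qS n (k + 1)

/-- Standardization: the order preserving bijection `S → [|S|]`. -/
def stdMap (S : Finset ℕ) (a : ℕ) : ℕ := (S.filter fun x => x ≤ a).card

/-- The standardized 2-block partition obtained from two blocks `A, B`. -/
def stdPair (A B : Finset ℕ) : Finset (Finset ℕ) :=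
  {A.image (stdMap (A ∪ B)), B.image (stdMap (A ∪ B))}

section

open Finset

/-- The set partitions of an arbitrary finite set `S`. -/
noncomputable def partitionsOf (S : Finset ℕ) : Finset (Finset (Finset ℕ)) :=
  S.powerset.powerset.filter fun P => IsPartition P S

lemma IsPartition.subset {P : Finset (Finset ℕ)} {S B : Finset ℕ} (hP : IsPartition P S)
    (hB : B ∈ P) : B ⊆ S :=
  hP.2.2 ▸ subset_biUnion_of_mem id hB

lemma mem_partitionsOf {S : Finset ℕ} {P : Finset (Finset ℕ)} :
    P ∈ partitionsOf S ↔ IsPartition P S := by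
  simp only [partitionsOf, mem_filter, mem_powerset, and_iff_right_iff_imp]
  exact fun h B hB => mem_powerset.2 (h.subset hB)

lemma IsPartition.union {P Q : Finset (Finset ℕ)} {S T : Finset ℕ} (hP : IsPartition P S)
    (hQ : IsPartition Q T) (hST : Disjoint S T) : IsPartition (P ∪ Q) (S ∪ T) := by
  refine ⟨by simp [hP.1, hQ.1], fun B hB C hC hne => ?_, ?_⟩
  · rcases mem_union.1 hB with hB | hB <;> rcases mem_union.1 hC with hC | hC
    · exact hP.2.1 B hB C hC hne
    · exact hST.mono (hP.subset hB) (hQ.subset hC)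
    · exact (hST.mono (hP.subset hC) (hQ.subset hB)).symm
    · exact hQ.2.1 B hB C hC hne
  · rw [union_biUnion, hP.2.2, hQ.2.2]

lemma IsPartition.sdiff {P F : Finset (Finset ℕ)} {S U : Finset ℕ} (hP : IsPartition P S)
    (hF : IsPartition F U) (hFP : F ⊆ P) : IsPartition (P \ F) (S \ U) := by
  refine ⟨fun h => hP.1 (mem_sdiff.1 h).1, fun B hB C hC hne =>
    hP.2.1 B (mem_sdiff.1 hB).1 C (mem_sdiff.1 hC).1 hne, ?_⟩
  rw [← hP.2.2, ← hF.2.2]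
  ext x
  simp only [mem_biUnion, mem_sdiff, id]
  constructor
  · rintro ⟨B, ⟨hB, hBF⟩, hx⟩
    refine ⟨⟨B, hB, hx⟩, ?_⟩
    rintro ⟨C, hC, hxC⟩
    exact disjoint_left.1 (hP.2.1 B hB C (hFP hC) (by rintro rfl; exact hBF hC)) hx hxC
  · rintro ⟨⟨B, hB, hx⟩, h⟩
    exact ⟨B, ⟨hB, fun hBF => h ⟨B, hBF, hx⟩⟩, hx⟩

lemma card_filter_subset_partitionsOf {F : Finset (Finset ℕ)} {S U : Finset ℕ}
    (hF : IsPartition F U) (hU : U ⊆ S) :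
    ((partitionsOf S).filter fun P => F ⊆ P).card = (partitionsOf (S \ U)).card := by
  refine card_bij' (fun P _ => P \ F) (fun Q _ => Q ∪ F) ?_ ?_ ?_ ?_
  · intro P hP
    rw [mem_filter, mem_partitionsOf] at hP
    exact mem_partitionsOf.2 (hP.1.sdiff hF hP.2)
  · intro Q hQ
    rw [mem_filter, mem_partitionsOf]
    refine ⟨?_, subset_union_right⟩
    have := (mem_partitionsOf.1 hQ).union hF sdiff_disjoint
    rwa [sdiff_union_of_subset hU] at this
  · intro P hP
    exact sdiff_union_of_subset (mem_filter.1 hP).2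
  · intro Q hQ
    refine union_sdiff_cancel_right (disjoint_left.2 fun B hB hBF => ?_)
    obtain ⟨x, hx⟩ := nonempty_iff_ne_empty.2 fun h : B = ∅ => hF.1 (h ▸ hBF)
    exact (mem_sdiff.1 ((mem_partitionsOf.1 hQ).subset hB hx)).2 (hF.subset hBF hx)

lemma isPartition_singleton {A : Finset ℕ} (hA : A.Nonempty) : IsPartition {A} A :=
  ⟨by simpa using hA.ne_empty.symm, by simp +contextual, by simp⟩

lemma isPartition_pair {A B : Finset ℕ} (hA : A.Nonempty) (hB : B.Nonempty)
    (hAB : Disjoint A B) : IsPartition {A, B} (A ∪ B) :=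
  (isPartition_singleton hA).union (isPartition_singleton hB) hAB

theorem card_partitionsOf (S : Finset ℕ) : (partitionsOf S).card = Nat.bell S.card := by
  induction S using Finset.strongInduction with
  | H S ih =>
  obtain rfl | ⟨a, ha⟩ := S.eq_empty_or_nonempty
  · have : partitionsOf ∅ = {∅} := by
      ext P
      rw [mem_partitionsOf, mem_singleton]
      refine ⟨fun h => eq_empty_of_forall_notMem fun B hB => h.1 ?_, ?_⟩
      · rwa [subset_empty.1 (h.subset hB)] at hB
      · rintro rfl
        simp [IsPartition]
    simp [this]
  · obtain ⟨T, haT, rfl⟩ : ∃ T, a ∉ T ∧ S = insert a T :=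
      ⟨S.erase a, notMem_erase a S, (insert_erase ha).symm⟩
    have hdecomp : partitionsOf (insert a T) = T.powerset.biUnion fun V =>
        (partitionsOf (insert a T)).filter fun P => {insert a V} ⊆ P := by
      ext P
      simp only [mem_biUnion, mem_powerset, mem_filter, singleton_subset_iff]
      refine ⟨fun hP => ?_, fun ⟨V, _, hP, _⟩ => hP⟩
      have hPp := mem_partitionsOf.1 hP
      obtain ⟨B, hB, haB⟩ := mem_biUnion.1 (hPp.2.2.symm ▸ mem_insert_self a T)
      refine ⟨B.erase a, ?_, hP, by rwa [insert_erase (s := B) haB]⟩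
      exact subset_insert_iff.1 (hPp.subset hB)
    rw [hdecomp, card_biUnion]
    · have key : ∀ V ∈ T.powerset,
          ((partitionsOf (insert a T)).filter fun P => {insert a V} ⊆ P).card
            = Nat.bell (T.card - V.card) := by
        intro V hV
        rw [mem_powerset] at hV
        rw [card_filter_subset_partitionsOf (isPartition_singleton (insert_nonempty a V))
          (insert_subset_insert a hV)]
        have : insert a T \ insert a V = T \ V := by
          ext x; simp only [mem_sdiff, mem_insert]; grind
        rw [this, ih _ ⟨sdiff_subset.trans (subset_insert a T), fun h =>
          haT (mem_sdiff.1 (h (mem_insert_self a T))).1⟩, card_sdiff_of_subset hV]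
      rw [sum_congr rfl key, sum_powerset_apply_card (fun k => Nat.bell (T.card - k)),
        card_insert_of_notMem haT, Nat.bell_succ, ← Nat.range_succ_eq_Iic]
      simp only [smul_eq_mul]
    · intro V hV W hW hne
      refine disjoint_left.2 fun P hP hP' => hne ?_
      simp only [mem_filter, singleton_subset_iff, mem_partitionsOf] at hP hP'
      have hVW : insert a V = insert a W := by
        by_contra h
        exact disjoint_left.1 (hP.1.2.1 _ hP.2 _ hP'.2 h) (mem_insert_self a V)
          (mem_insert_self a W)
      have hV : a ∉ V := fun h => haT (mem_powerset.1 hV h)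
      have hW : a ∉ W := fun h => haT (mem_powerset.1 hW h)
      rw [← erase_insert hV, hVW, erase_insert hW]

lemma bell_eq (n : ℕ) : bell n = Nat.bell n := by
  have : bell n = (partitionsOf (seg n)).card := rfl
  rw [this, card_partitionsOf, seg, Nat.card_Icc, Nat.add_sub_cancel]

lemma Overlap.ne {A B : Finset ℕ} (h : Overlap A B) : A ≠ B := by
  rintro rfl
  obtain ⟨_, _, h, -⟩ := h
  exact h.false

lemma sum_ov_partitionsOf (S : Finset ℕ) :
    ∑ P ∈ partitionsOf S, ov P = ∑ U ∈ S.powerset,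
      (U.powerset.filter fun A => Overlap A (U \ A)).card * Nat.bell (S.card - U.card) := by
  set Q := (S.powerset ×ˢ S.powerset).filter fun p => Overlap p.1 p.2 ∧ Disjoint p.1 p.2 with hQ
  have hov : ∀ P ∈ partitionsOf S,
      ov P = (Q.filter fun p => p.1 ∈ P ∧ p.2 ∈ P).card := by
    intro P hP
    rw [mem_partitionsOf] at hP
    refine Nat.subtype_card _ fun p => ?_
    simp only [hQ, mem_filter, mem_product, mem_powerset]
    exact ⟨fun h => ⟨h.2.1, h.2.2, h.1.2.1⟩, fun h => ⟨⟨⟨hP.subset h.1, hP.subset h.2.1⟩, h.2.2,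
      hP.2.1 _ h.1 _ h.2.1 h.2.2.ne⟩, h.1, h.2.1⟩⟩
  rw [sum_congr rfl hov]
  refine (sum_card_bipartiteAbove_eq_sum_card_bipartiteBelow
    (r := fun (P : Finset (Finset ℕ)) (p : Finset ℕ × Finset ℕ) => p.1 ∈ P ∧ p.2 ∈ P)).trans ?_
  have hcard : ∀ p ∈ Q, ((partitionsOf S).filter fun P => p.1 ∈ P ∧ p.2 ∈ P).card
      = Nat.bell (S.card - (p.1 ∪ p.2).card) := by
    rintro ⟨A, B⟩ hp
    simp only [hQ, mem_filter, mem_product, mem_powerset] at hp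
    obtain ⟨⟨hA, hB⟩, ⟨hA', hB', -⟩, hAB⟩ := hp
    have := card_filter_subset_partitionsOf (isPartition_pair hA' hB' hAB) (union_subset hA hB)
    rw [card_partitionsOf, card_sdiff_of_subset (union_subset hA hB)] at this
    simpa only [insert_subset_iff, singleton_subset_iff] using this
  simp only [bipartiteBelow]
  rw [sum_congr rfl hcard]
  simp only [card_eq_sum_ones (filter _ _), sum_mul, one_mul]
  rw [sum_sigma']
  refine sum_bij' (fun p _ => ⟨p.1 ∪ p.2, p.1⟩) (fun q _ => (q.2, q.1 \ q.2)) ?_ ?_ ?_ ?_ ?_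
  · rintro ⟨A, B⟩ hp
    simp only [hQ, mem_filter, mem_product, mem_powerset] at hp
    simp only [mem_sigma, mem_filter, mem_powerset, union_sdiff_cancel_left hp.2.2]
    exact ⟨union_subset hp.1.1 hp.1.2, subset_union_left, hp.2.1⟩
  · rintro ⟨U, A⟩ hq
    simp only [mem_sigma, mem_filter, mem_powerset] at hq
    simp only [hQ, mem_filter, mem_product, mem_powerset]
    exact ⟨⟨hq.2.1.trans hq.1, sdiff_subset.trans hq.1⟩, hq.2.2, disjoint_sdiff⟩
  · rintro ⟨A, B⟩ hp
    simp only [hQ, mem_filter] at hp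
    simp only [union_sdiff_cancel_left hp.2.2]
  · rintro ⟨U, A⟩ hq
    simp only [mem_sigma, mem_filter, mem_powerset] at hq
    simp only [union_sdiff_of_subset hq.2.1]
  · intros; rfl

lemma overlap_sdiff_iff {U A : Finset ℕ} (hU : U.Nonempty) (hA : A ⊆ U) :
    Overlap A (U \ A) ↔
      (U.min' hU ∈ A ∧ U.max' hU ∉ A) ∧ ∃ x ∈ A, ∃ y ∈ U \ A, y < x := by
  constructor
  · rintro ⟨h, h', h₁, h₂, h₃⟩
    refine ⟨⟨?_, fun hmax => ?_⟩, A.max' h, max'_mem _ _, _, min'_mem _ h', h₂⟩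
    · by_contra hmin
      exact h₁.not_ge ((min'_le _ _ (mem_sdiff.2 ⟨min'_mem _ hU, hmin⟩)).trans
        (min'_le _ _ (hA (min'_mem _ h))))
    · exact h₃.not_ge ((le_max' _ _ (mem_sdiff.1 (max'_mem _ h')).1).trans (le_max' _ _ hmax))
  · rintro ⟨⟨hmin, hmax⟩, x, hx, y, hy, hyx⟩
    have h : A.Nonempty := ⟨x, hx⟩
    have h' : (U \ A).Nonempty := ⟨y, hy⟩
    refine ⟨h, h', ?_, (min'_le _ _ hy).trans_lt (hyx.trans_le (le_max' _ _ hx)), ?_⟩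
    · have hm := mem_sdiff.1 (min'_mem _ h')
      refine ((min'_le _ _ hmin).trans (min'_le _ _ hm.1)).lt_of_ne fun heq => hm.2 ?_
      exact heq ▸ min'_mem _ h
    · have hm := max'_mem _ h
      refine ((le_max' _ _ (hA hm)).trans (le_max' _ _
        (mem_sdiff.2 ⟨max'_mem _ hU, hmax⟩))).lt_of_ne fun heq => ?_
      exact (mem_sdiff.1 (max'_mem _ h')).2 (heq ▸ hm)

lemma card_filter_mem_notMem {U : Finset ℕ} {a b : ℕ} (ha : a ∈ U) (hb : b ∈ U) (hab : a ≠ b) :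
    (U.powerset.filter fun A => a ∈ A ∧ b ∉ A).card = 2 ^ (U.card - 2) := by
  have : (U.powerset.filter fun A => a ∈ A ∧ b ∉ A)
      = ((U.erase b).erase a).powerset.image (insert a) := by
    ext A
    simp only [mem_filter, mem_powerset, mem_image]
    constructor
    · rintro ⟨hA, haA, hbA⟩
      exact ⟨A.erase a, erase_subset_erase a (subset_erase.2 ⟨hA, hbA⟩), insert_erase haA⟩
    · rintro ⟨V, hV, rfl⟩
      refine ⟨?_, mem_insert_self a V, ?_⟩
      · exact insert_subset ha (hV.trans ((erase_subset _ _).trans (erase_subset _ _)))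
      · intro h
        rcases mem_insert.1 h with h | h
        · exact hab h.symm
        · simpa using hV h
  rw [this, card_image_of_injOn, card_powerset, card_erase_of_mem (mem_erase.2 ⟨hab, ha⟩),
    card_erase_of_mem hb, Nat.sub_sub]
  intro V hV W hW h
  simp only [coe_powerset, Set.mem_preimage, Set.mem_powerset_iff, coe_subset] at hV hW
  have hV : a ∉ V := fun h => by simpa using hV h
  have hW : a ∉ W := fun h => by simpa using hW h
  rw [← erase_insert hV, h, erase_insert hW]

lemma card_filter_initial_segment {U : Finset ℕ} (hU : U.Nonempty) :
    (U.powerset.filter fun A => (U.min' hU ∈ A ∧ U.max' hU ∉ A) ∧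
      ¬ ∃ x ∈ A, ∃ y ∈ U \ A, y < x).card = U.card - 1 := by
  rw [← card_erase_of_mem (max'_mem U hU)]
  symm
  refine card_bij (fun u _ => U.filter (· ≤ u)) ?_ ?_ ?_
  · intro u hu
    obtain ⟨hne, hu⟩ := mem_erase.1 hu
    simp only [mem_filter, mem_powerset, mem_sdiff]
    refine ⟨filter_subset _ _, ⟨⟨min'_mem _ _, min'_le _ _ hu⟩, fun h => ?_⟩, ?_⟩
    · exact hne (le_antisymm (le_max' _ _ hu) h.2)
    · rintro ⟨x, ⟨-, hx⟩, y, ⟨hy, hy'⟩, hyx⟩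
      exact hy' ⟨hy, hyx.le.trans hx⟩
  · intro u hu v hv h
    have hu := (mem_erase.1 hu).2
    have hv := (mem_erase.1 hv).2
    have h₁ : u ∈ U.filter (· ≤ v) := h ▸ mem_filter.2 ⟨hu, le_rfl⟩
    have h₂ : v ∈ U.filter (· ≤ u) := h ▸ mem_filter.2 ⟨hv, le_rfl⟩
    exact le_antisymm (mem_filter.1 h₁).2 (mem_filter.1 h₂).2
  · intro A hA
    simp only [mem_filter, mem_powerset] at hA
    obtain ⟨hA, ⟨hmin, hmax⟩, h⟩ := hA
    have hne : A.Nonempty := ⟨_, hmin⟩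
    refine ⟨A.max' hne, mem_erase.2 ⟨fun heq => hmax (heq ▸ max'_mem _ hne), hA (max'_mem _ hne)⟩,
      ?_⟩
    ext x
    rw [mem_filter]
    refine ⟨fun ⟨hx, hle⟩ => ?_, fun hx => ⟨hA hx, le_max' _ _ hx⟩⟩
    by_contra hxA
    exact h ⟨_, max'_mem _ hne, x, mem_sdiff.2 ⟨hx, hxA⟩,
      hle.lt_of_ne fun heq => hxA (heq ▸ max'_mem _ hne)⟩

lemma card_filter_overlap_sdiff (U : Finset ℕ) :
    ((U.powerset.filter fun A => Overlap A (U \ A)).card : ℚ)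
      = 2 ^ U.card / 4 - U.card + 1 - (if U.card = 0 then 5 / 4 else 0)
        - (if U.card = 1 then 1 / 2 else 0) := by
  obtain rfl | hU := U.eq_empty_or_nonempty
  · have : (powerset (∅ : Finset ℕ)).filter (fun A => Overlap A (∅ \ A)) = ∅ :=
      filter_eq_empty_iff.2 fun A _ h => by obtain ⟨_, h', -⟩ := h; simp at h'
    rw [this]
    norm_num
  have hsplit := card_filter_add_card_filter_not
    (s := U.powerset.filter fun A => U.min' hU ∈ A ∧ U.max' hU ∉ A)
    (fun A => ∃ x ∈ A, ∃ y ∈ U \ A, y < x)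
  rw [filter_filter, filter_filter, card_filter_initial_segment hU] at hsplit
  rw [filter_congr fun A hA => overlap_sdiff_iff hU (mem_powerset.1 hA)]
  obtain hlt | heq := (min'_le_max' U hU).lt_or_eq
  · rw [card_filter_mem_notMem (min'_mem _ _) (max'_mem _ _) hlt.ne] at hsplit
    have h2 : 2 ≤ U.card := one_lt_card.2 ⟨_, min'_mem _ hU, _, max'_mem _ hU, hlt.ne⟩
    obtain ⟨m, hm⟩ := Nat.exists_eq_add_of_le' h2
    rw [hm] at hsplit ⊢
    simp only [Nat.add_sub_cancel, show m + 2 - 1 = m + 1 from rfl] at hsplit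
    have := congrArg (Nat.cast (R := ℚ)) hsplit
    push_cast at this ⊢
    simp only [pow_add]
    linarith
  · have h1 : U.card = 1 := by
      refine card_eq_one.2 ⟨U.min' hU, eq_singleton_iff_unique_mem.2 ⟨min'_mem _ _, fun x hx => ?_⟩⟩
      exact le_antisymm (heq ▸ le_max' _ _ hx) (min'_le _ _ hx)
    have : U.powerset.filter (fun A => U.min' hU ∈ A ∧ U.max' hU ∉ A) = ∅ :=
      filter_eq_empty_iff.2 fun A _ h => h.2 (heq ▸ h.1)
    rw [← filter_filter, this, h1]
    norm_num

/-- The umbral functional `X ^ n ↦ B_n`. -/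
noncomputable def bellFunctional : Polynomial ℚ →ₗ[ℚ] ℚ :=
  Polynomial.lsum fun n => (Nat.bell n : ℚ) • LinearMap.id

lemma bellFunctional_X_pow (n : ℕ) :
    bellFunctional (Polynomial.X ^ n) = Nat.bell n := by
  simp [bellFunctional, ← Polynomial.monomial_one_right_eq_X_pow, Polynomial.sum_monomial_index]

lemma bellFunctional_X_add_C_pow (a : ℚ) (n : ℕ) :
    bellFunctional ((Polynomial.X + Polynomial.C a) ^ n)
      = ∑ k ∈ range (n + 1), n.choose k * a ^ k * Nat.bell (n - k) := by
  rw [add_comm, add_pow, map_sum]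
  refine sum_congr rfl fun k _ => ?_
  have : Polynomial.C a ^ k * Polynomial.X ^ (n - k) * ((n.choose k : ℕ) : Polynomial ℚ)
      = ((n.choose k : ℚ) * a ^ k) • (Polynomial.X ^ (n - k) : Polynomial ℚ) := by
    rw [Polynomial.smul_eq_C_mul]
    simp only [map_mul, map_pow, map_natCast]
    ring
  rw [this, map_smul, bellFunctional_X_pow, smul_eq_mul]

lemma sum_choose_mul_bell (n : ℕ) :
    ∑ k ∈ range (n + 1), (n.choose k : ℚ) * Nat.bell (n - k) = Nat.bell (n + 1) := by
  rw [Nat.bell_succ, ← Nat.range_succ_eq_Iic]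
  push_cast
  rfl

lemma bellFunctional_comp_X_add_one (p : Polynomial ℚ) :
    bellFunctional (p.comp (Polynomial.X + Polynomial.C 1)) = bellFunctional (Polynomial.X * p) := by
  induction p using Polynomial.induction_on' with
  | add p q hp hq => simp only [Polynomial.add_comp, mul_add, map_add, hp, hq]
  | monomial n a =>
    rw [← Polynomial.C_mul_X_pow_eq_monomial, Polynomial.mul_comp, Polynomial.C_comp,
      Polynomial.X_pow_comp, mul_left_comm, ← pow_succ', ← Polynomial.smul_eq_C_mul,
      ← Polynomial.smul_eq_C_mul, map_smul, map_smul, bellFunctional_X_pow,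
      bellFunctional_X_add_C_pow, ← sum_choose_mul_bell]
    simp only [one_pow, mul_one]

lemma sum_choose_mul_two_pow_mul_bell (n : ℕ) :
    ∑ k ∈ range (n + 1), (n.choose k : ℚ) * 2 ^ k * Nat.bell (n - k)
      = Nat.bell (n + 2) - Nat.bell (n + 1) := by
  have shift (m : ℕ) :
      bellFunctional ((Polynomial.X + Polynomial.C 1) ^ m) = Nat.bell (m + 1) := by
    rw [bellFunctional_X_add_C_pow, ← sum_choose_mul_bell]
    simp only [one_pow, mul_one]
  have h2 : (Polynomial.X + Polynomial.C 2 : Polynomial ℚ) ^ n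
      = ((Polynomial.X + Polynomial.C 1) ^ n : Polynomial ℚ).comp
        (Polynomial.X + Polynomial.C 1) := by
    rw [Polynomial.pow_comp, Polynomial.add_comp, Polynomial.X_comp, Polynomial.C_comp, add_assoc,
      ← Polynomial.C_add, one_add_one_eq_two]
  have hX : (Polynomial.X * (Polynomial.X + Polynomial.C 1) ^ n : Polynomial ℚ)
      = (Polynomial.X + Polynomial.C 1) ^ (n + 1) - (Polynomial.X + Polynomial.C 1) ^ n := by
    rw [Polynomial.C_1]
    ring
  rw [← bellFunctional_X_add_C_pow, h2, bellFunctional_comp_X_add_one, hX, map_sub, shift, shift]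

lemma sum_choose_mul_self_mul_bell {n : ℕ} (hn : 1 ≤ n) :
    ∑ k ∈ range (n + 1), (n.choose k : ℚ) * k * Nat.bell (n - k) = n * Nat.bell n := by
  obtain ⟨m, rfl⟩ := Nat.exists_eq_add_of_le' hn
  rw [sum_range_succ', ← sum_choose_mul_bell, mul_sum]
  simp only [Nat.cast_zero, mul_zero, zero_mul, add_zero, Nat.add_sub_add_right]
  refine sum_congr rfl fun k _ => ?_
  have := congrArg (Nat.cast (R := ℚ)) (Nat.add_one_mul_choose_eq m k)
  push_cast at this ⊢
  rw [← this, mul_assoc]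

lemma sum_ov_partitions (n : ℕ) (hn : 1 ≤ n) :
    (∑ π ∈ partitions n, (ov π : ℚ))
        = (1/4) * (bell (n+2) : ℚ) + (3/4) * (bell (n+1) : ℚ)
            - ((n : ℚ) + 5/4) * (bell n : ℚ) - ((n : ℚ)/2) * (bell (n-1) : ℚ) := by
  have hcard : (seg n).card = n := by simp [seg]
  have h : (∑ π ∈ partitions n, (ov π : ℚ)) = ∑ k ∈ range (n + 1), (n.choose k : ℚ) *
      ((2 ^ k / 4 - k + 1 - (if k = 0 then 5 / 4 else 0) - (if k = 1 then 1 / 2 else 0))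
        * Nat.bell (n - k)) := by
    have h := congrArg (Nat.cast (R := ℚ)) (sum_ov_partitionsOf (seg n))
    push_cast at h
    simp only [card_filter_overlap_sdiff, hcard] at h
    refine Eq.trans h ?_
    rw [sum_powerset_apply_card (fun k : ℕ =>
      ((2 ^ k / 4 - k + 1 - (if k = 0 then 5 / 4 else 0) - (if k = 1 then 1 / 2 else 0) : ℚ)
        * Nat.bell (n - k))), hcard]
    simp only [nsmul_eq_mul]
  have h0 : ∑ k ∈ range (n + 1), (n.choose k : ℚ) * (if k = 0 then 5 / 4 else 0)
      * Nat.bell (n - k) = 5 / 4 * Nat.bell n := by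
    rw [sum_eq_single_of_mem 0 (by simp) fun k _ hk => by simp [hk]]
    simp
  have h1 : ∑ k ∈ range (n + 1), (n.choose k : ℚ) * (if k = 1 then 1 / 2 else 0)
      * Nat.bell (n - k) = n / 2 * Nat.bell (n - 1) := by
    rw [sum_eq_single_of_mem 1 (mem_range.2 (by omega)) fun k _ hk => by simp [hk]]
    simp [div_eq_mul_inv]
  simp only [bell_eq]
  have hsplit : ∀ k ∈ range (n + 1), (n.choose k : ℚ) *
      ((2 ^ k / 4 - k + 1 - (if k = 0 then 5 / 4 else 0) - (if k = 1 then 1 / 2 else 0))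
        * Nat.bell (n - k))
      = 1 / 4 * ((n.choose k : ℚ) * 2 ^ k * Nat.bell (n - k))
        - (n.choose k : ℚ) * k * Nat.bell (n - k) + (n.choose k : ℚ) * Nat.bell (n - k)
        - (n.choose k : ℚ) * (if k = 0 then 5 / 4 else 0) * Nat.bell (n - k)
        - (n.choose k : ℚ) * (if k = 1 then 1 / 2 else 0) * Nat.bell (n - k) :=
    fun k _ => by ring
  rw [h, sum_congr rfl hsplit, sum_sub_distrib, sum_sub_distrib, sum_add_distrib, sum_sub_distrib,
    ← mul_sum, h0, h1, sum_choose_mul_two_pow_mul_bell, sum_choose_mul_self_mul_bell hn,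
    sum_choose_mul_bell]
  ring

end

/-- exact total and average number of overlappings over `Π_n`. -/
theorem ov_mean_over_partitions (n : ℕ) (hn : 1 ≤ n) :
    (∑ π ∈ partitions n, (ov π : ℚ))
        = (1/4) * (bell (n+2) : ℚ) + (3/4) * (bell (n+1) : ℚ)
            - ((n : ℚ) + 5/4) * (bell n : ℚ) - ((n : ℚ)/2) * (bell (n-1) : ℚ) ∧
    (∑ π ∈ partitions n, (ov π : ℚ)) / (bell n : ℚ)
        = ((1/4) * (bell (n+2) : ℚ) + (3/4) * (bell (n+1) : ℚ)
            - ((n : ℚ) + 5/4) * (bell n : ℚ) - ((n : ℚ)/2) * (bell (n-1) : ℚ)) / (bell n : ℚ) := by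
  have h := sum_ov_partitions n hn
  exact ⟨h, by rw [h]⟩
end

section
/- For all integers n ≥ k ≥ 1 one has the identity (in ℚ): Σ_{π ∈ Π_n^k} ov(π) = (k(k−1)/4)·S_{n,k} − (3/2)·(n+1−k)·S_{n,k−1} + (n(k−1)/2)·S_{n−1,k−1}. Equivalently, the average number of overlappings in a random set partition of [n] into k blocks equals this quantity divided by S_{n,k}. -/
open scoped Classical

/-- The partitions of `S` into exactly `k` blocks. -/
noncomputable def blockPartitions (S : Finset ℕ) (k : ℕ) : Finset (Finset (Finset ℕ)) :=
  S.powerset.powerset.filter fun P => IsPartition P S ∧ P.card = k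

theorem IsPartition.subset_s8 {P : Finset (Finset ℕ)} {S A : Finset ℕ} (h : IsPartition P S)
    (hA : A ∈ P) : A ⊆ S := by
  rw [← h.2.2]
  exact Finset.subset_biUnion_of_mem id hA

theorem mem_blockPartitions {P : Finset (Finset ℕ)} {S : Finset ℕ} {k : ℕ} :
    P ∈ blockPartitions S k ↔ IsPartition P S ∧ P.card = k := by
  simp only [blockPartitions, Finset.mem_filter, Finset.mem_powerset, and_iff_right_iff_imp]
  intro h A hA
  exact Finset.mem_powerset.2 (h.1.subset_s8 hA)

theorem partitionsK_eq_blockPartitions (n k : ℕ) :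
    partitionsK n k = blockPartitions (seg n) k := by
  simp [partitionsK, partitions, blockPartitions, Finset.filter_filter]

theorem IsPartition.erase {P : Finset (Finset ℕ)} {S A : Finset ℕ} (h : IsPartition P S)
    (hA : A ∈ P) : IsPartition (P.erase A) (S \ A) := by
  refine ⟨fun h0 => h.1 (Finset.mem_of_mem_erase h0), fun B hB C hC =>
    h.2.1 B (Finset.mem_of_mem_erase hB) C (Finset.mem_of_mem_erase hC), ?_⟩
  ext x
  simp only [Finset.mem_biUnion, Finset.mem_erase, id, Finset.mem_sdiff, ← h.2.2]
  constructor
  · rintro ⟨B, ⟨hBA, hB⟩, hx⟩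
    exact ⟨⟨B, hB, hx⟩, Finset.disjoint_left.1 (h.2.1 B hB A hA hBA) hx⟩
  · rintro ⟨⟨B, hB, hx⟩, hxA⟩
    exact ⟨B, ⟨fun e => hxA (e ▸ hx), hB⟩, hx⟩

theorem IsPartition.notMem_of_sdiff {Q : Finset (Finset ℕ)} {S A : Finset ℕ}
    (h : IsPartition Q (S \ A)) (hA : A ≠ ∅) : A ∉ Q := by
  intro hQ
  obtain ⟨x, hx⟩ := Finset.nonempty_iff_ne_empty.2 hA
  exact (Finset.mem_sdiff.1 (h.subset_s8 hQ hx)).2 hx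

theorem IsPartition.insert {Q : Finset (Finset ℕ)} {S A : Finset ℕ}
    (h : IsPartition Q (S \ A)) (hA : A ≠ ∅) (hAS : A ⊆ S) : IsPartition (insert A Q) S := by
  have hd : ∀ B ∈ Q, Disjoint B A := fun B hB =>
    Finset.disjoint_left.2 fun x hx => (Finset.mem_sdiff.1 (h.subset_s8 hB hx)).2
  refine ⟨?_, ?_, ?_⟩
  · simp only [Finset.mem_insert, not_or]
    exact ⟨hA.symm, h.1⟩
  · intro B hB C hC hBC
    rcases Finset.mem_insert.1 hB with rfl | hB' <;> rcases Finset.mem_insert.1 hC with rfl | hC'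
    · exact absurd rfl hBC
    · exact (hd C hC').symm
    · exact hd B hB'
    · exact h.2.1 B hB' C hC' hBC
  · rw [Finset.biUnion_insert, h.2.2]
    exact Finset.union_sdiff_of_subset hAS

/-- Summing over the partitions with a marked block. -/
theorem sum_blockPartitions_marked (S : Finset ℕ) (k : ℕ)
    (g : Finset ℕ → Finset (Finset ℕ) → ℕ) :
    ∑ P ∈ blockPartitions S (k + 1), ∑ A ∈ P, g A (P.erase A)
      = ∑ A ∈ S.powerset.erase ∅, ∑ Q ∈ blockPartitions (S \ A) k, g A Q := by
  rw [Finset.sum_sigma', Finset.sum_sigma']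
  refine Finset.sum_bij' (fun p _ => ⟨p.2, p.1.erase p.2⟩) (fun q _ => ⟨insert q.1 q.2, q.1⟩)
    ?_ ?_ ?_ ?_ ?_
  · rintro ⟨P, A⟩ h
    simp only [Finset.mem_sigma, mem_blockPartitions, Finset.mem_erase,
      Finset.mem_powerset] at h ⊢
    obtain ⟨⟨hP, hc⟩, hA⟩ := h
    exact ⟨⟨fun e => hP.1 (e ▸ hA), hP.subset_s8 hA⟩, hP.erase hA,
      by rw [Finset.card_erase_of_mem hA, hc, Nat.add_sub_cancel]⟩
  · rintro ⟨A, Q⟩ h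
    simp only [Finset.mem_sigma, mem_blockPartitions, Finset.mem_erase,
      Finset.mem_powerset] at h ⊢
    obtain ⟨⟨hA, hAS⟩, hQ, hc⟩ := h
    exact ⟨⟨hQ.insert hA hAS, by rw [Finset.card_insert_of_notMem (hQ.notMem_of_sdiff hA), hc]⟩,
      Finset.mem_insert_self _ _⟩
  · rintro ⟨P, A⟩ h
    simp only [Finset.mem_sigma] at h
    simp only [Finset.insert_erase h.2]
  · rintro ⟨A, Q⟩ h
    simp only [Finset.mem_sigma, mem_blockPartitions, Finset.mem_erase] at h
    simp only [Finset.erase_insert (h.2.1.notMem_of_sdiff h.1.1)]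
  · rintro ⟨P, A⟩ h
    rfl

theorem sum_blockPartitions_weight (S : Finset ℕ) (k : ℕ) (f : Finset ℕ → ℕ) :
    ∑ P ∈ blockPartitions S (k + 1), ∑ A ∈ P, f A
      = ∑ A ∈ S.powerset.erase ∅, f A * (blockPartitions (S \ A) k).card := by
  rw [sum_blockPartitions_marked S k fun A _ => f A]
  simp [mul_comm]

theorem card_blockPartitions_marked (S : Finset ℕ) (k : ℕ) :
    (k + 1) * (blockPartitions S (k + 1)).card
      = ∑ A ∈ S.powerset.erase ∅, (blockPartitions (S \ A) k).card := by
  have h := sum_blockPartitions_weight S k fun _ => 1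
  simp only [one_mul] at h
  rw [← h, mul_comm, ← smul_eq_mul, ← Finset.sum_const]
  refine Finset.sum_congr rfl fun P hP => ?_
  rw [← Finset.card_eq_sum_ones, (mem_blockPartitions.1 hP).2]

theorem card_blockPartitions_insert {S : Finset ℕ} {x : ℕ} (hx : x ∉ S) (k : ℕ) :
    (blockPartitions (insert x S) (k + 1)).card
      = ∑ A ∈ S.powerset, (blockPartitions (S \ A) k).card := by
  have h := sum_blockPartitions_weight (insert x S) k fun A => if x ∈ A then 1 else 0
  have hl : ∑ P ∈ blockPartitions (insert x S) (k + 1), ∑ A ∈ P, (if x ∈ A then 1 else 0)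
      = (blockPartitions (insert x S) (k + 1)).card := by
    rw [Finset.card_eq_sum_ones]
    refine Finset.sum_congr rfl fun P hP => ?_
    have hP := (mem_blockPartitions.1 hP).1
    obtain ⟨A, hA, hxA⟩ : ∃ A ∈ P, x ∈ A := by
      have : x ∈ P.biUnion id := hP.2.2 ▸ Finset.mem_insert_self x S
      simpa using this
    rw [Finset.sum_eq_single A, if_pos hxA]
    · intro B hB hBA
      exact if_neg fun hxB => Finset.disjoint_left.1 (hP.2.1 B hB A hA hBA) hxB hxA
    · exact fun h => absurd hA h
  rw [← hl, h]
  simp only [ite_mul, one_mul, zero_mul]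
  rw [← Finset.sum_filter]
  refine Finset.sum_bij' (fun A _ => A.erase x) (fun A _ => insert x A) ?_ ?_ ?_ ?_ ?_
  · intro A hA
    simp only [Finset.mem_filter, Finset.mem_erase, Finset.mem_powerset] at hA ⊢
    exact Finset.subset_insert_iff.1 hA.1.2
  · intro A hA
    simp only [Finset.mem_filter, Finset.mem_erase, Finset.mem_powerset] at hA ⊢
    exact ⟨⟨Finset.insert_ne_empty _ _, Finset.insert_subset_insert _ hA⟩,
      Finset.mem_insert_self _ _⟩
  · intro A hA
    exact Finset.insert_erase (Finset.mem_filter.1 hA).2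
  · intro A hA
    exact Finset.erase_insert fun h => hx (Finset.mem_powerset.1 hA h)
  · intro A hA
    congr 2
    ext y
    have := (Finset.mem_filter.1 hA).2
    grind

theorem card_blockPartitions (S : Finset ℕ) (k : ℕ) :
    (blockPartitions S k).card = Nat.stirlingSecond S.card k := by
  induction S using Finset.induction_on generalizing k with
  | empty =>
    cases k with
    | zero =>
      rw [Finset.card_empty, Nat.stirlingSecond_zero, Finset.card_eq_one]
      refine ⟨∅, ?_⟩
      ext P
      simp only [mem_blockPartitions, Finset.mem_singleton, Finset.card_eq_zero]
      exact ⟨fun h => h.2, fun h => ⟨by subst h; simp [IsPartition], h⟩⟩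
    | succ k =>
      have h := card_blockPartitions_marked ∅ k
      simpa using h
  | insert x S hx ih =>
    rw [Finset.card_insert_of_notMem hx]
    cases k with
    | zero =>
      rw [Nat.stirlingSecond_succ_zero, Finset.card_eq_zero]
      ext P
      simp only [mem_blockPartitions, Finset.card_eq_zero, Finset.notMem_empty, iff_false]
      rintro ⟨hP, rfl⟩
      exact Finset.insert_ne_empty x S hP.2.2.symm
    | succ k =>
      rw [card_blockPartitions_insert hx, Nat.stirlingSecond_succ_succ, ← ih, ← ih,
        card_blockPartitions_marked, ← Finset.add_sum_erase _ _ (Finset.empty_mem_powerset S),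
        Finset.sdiff_empty, add_comm]

theorem stirling_eq_stirlingSecond (n k : ℕ) : stirling n k = Nat.stirlingSecond n k := by
  rw [stirling, partitionsK_eq_blockPartitions, card_blockPartitions, seg, Nat.card_Icc,
    Nat.add_sub_cancel]

theorem sum_powerset_stirlingSecond (S : Finset ℕ) (k : ℕ) :
    ∑ A ∈ S.powerset, Nat.stirlingSecond (S \ A).card k
      = Nat.stirlingSecond (S.card + 1) (k + 1) := by
  obtain ⟨x, hx⟩ := Infinite.exists_notMem_finset S
  rw [← Finset.card_insert_of_notMem hx, ← card_blockPartitions, card_blockPartitions_insert hx]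
  simp only [card_blockPartitions]

/-- Summing over disjoint pairs of subsets, grouped by their union. -/
theorem sum_powerset_sdiff {M : Type*} [AddCommMonoid M] (S : Finset ℕ)
    (h : Finset ℕ → Finset ℕ → M) :
    ∑ A ∈ S.powerset, ∑ B ∈ (S \ A).powerset, h A B
      = ∑ T ∈ S.powerset, ∑ A ∈ T.powerset, h A (T \ A) := by
  rw [Finset.sum_sigma', Finset.sum_sigma']
  refine Finset.sum_bij' (fun p _ => ⟨p.1 ∪ p.2, p.1⟩) (fun q _ => ⟨q.2, q.1 \ q.2⟩)
    ?_ ?_ ?_ ?_ ?_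
  · rintro ⟨A, B⟩ hp
    simp only [Finset.mem_sigma, Finset.mem_powerset] at hp ⊢
    exact ⟨Finset.union_subset hp.1 (hp.2.trans Finset.sdiff_subset), Finset.subset_union_left⟩
  · rintro ⟨T, A⟩ hp
    simp only [Finset.mem_sigma, Finset.mem_powerset] at hp ⊢
    exact ⟨hp.2.trans hp.1, Finset.sdiff_subset_sdiff hp.1 subset_rfl⟩
  · rintro ⟨A, B⟩ hp
    simp only [Finset.mem_sigma, Finset.mem_powerset, Finset.subset_sdiff] at hp
    simp only [Finset.union_sdiff_cancel_left hp.2.2.symm]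
  · rintro ⟨T, A⟩ hp
    simp only [Finset.mem_sigma, Finset.mem_powerset] at hp
    simp only [Finset.union_sdiff_of_subset hp.2]
  · rintro ⟨A, B⟩ hp
    simp only [Finset.mem_sigma, Finset.mem_powerset, Finset.subset_sdiff] at hp
    simp only [Finset.union_sdiff_cancel_left hp.2.2.symm]

theorem sum_powerset_two_pow_mul_stirlingSecond (S : Finset ℕ) (k : ℕ) :
    ∑ T ∈ S.powerset, 2 ^ T.card * Nat.stirlingSecond (S \ T).card k
      = (k + 1) * Nat.stirlingSecond (S.card + 1) (k + 2)
        + Nat.stirlingSecond (S.card + 1) (k + 1) := by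
  have h := sum_powerset_sdiff S fun A B => Nat.stirlingSecond (S \ (A ∪ B)).card k
  have hr : ∀ T ∈ S.powerset,
      ∑ A ∈ T.powerset, Nat.stirlingSecond (S \ (A ∪ T \ A)).card k
        = 2 ^ T.card * Nat.stirlingSecond (S \ T).card k := by
    intro T _
    rw [← Finset.card_powerset, ← smul_eq_mul, ← Finset.sum_const]
    refine Finset.sum_congr rfl fun A hA => ?_
    rw [Finset.union_sdiff_of_subset (Finset.mem_powerset.1 hA)]
  rw [← Finset.sum_congr rfl hr, ← h, ← sum_powerset_stirlingSecond S (k + 1),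
    ← sum_powerset_stirlingSecond S k, Finset.mul_sum, ← Finset.sum_add_distrib]
  refine Finset.sum_congr rfl fun A _ => ?_
  rw [← Nat.stirlingSecond_succ_succ, ← sum_powerset_stirlingSecond]
  refine Finset.sum_congr rfl fun B _ => ?_
  rw [Finset.sdiff_sdiff_left', Finset.sdiff_union_distrib]

theorem sum_powerset_card_mul_stirlingSecond (S : Finset ℕ) (k : ℕ) :
    ∑ T ∈ S.powerset, T.card * Nat.stirlingSecond (S \ T).card k
      = S.card * Nat.stirlingSecond S.card (k + 1) := by
  have hl : ∀ T ∈ S.powerset, T.card * Nat.stirlingSecond (S \ T).card k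
      = ∑ x ∈ S, if x ∈ T then Nat.stirlingSecond (S \ T).card k else 0 := by
    intro T hT
    rw [← Finset.sum_filter, Finset.sum_const, smul_eq_mul, Finset.filter_mem_eq_inter,
      Finset.inter_eq_right.2 (Finset.mem_powerset.1 hT)]
  rw [Finset.sum_congr rfl hl, Finset.sum_comm, ← smul_eq_mul, ← Finset.sum_const]
  refine Finset.sum_congr rfl fun x hx => ?_
  have hc : S.card = (S.erase x).card + 1 := (Finset.card_erase_add_one hx).symm
  rw [← Finset.sum_filter, hc, ← sum_powerset_stirlingSecond]
  refine Finset.sum_bij' (fun A _ => A.erase x) (fun A _ => insert x A) ?_ ?_ ?_ ?_ ?_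
  · intro A hA
    simp only [Finset.mem_filter, Finset.mem_powerset] at hA ⊢
    exact Finset.erase_subset_erase x hA.1
  · intro A hA
    simp only [Finset.mem_filter, Finset.mem_powerset] at hA ⊢
    exact ⟨Finset.insert_subset hx (hA.trans (Finset.erase_subset _ _)),
      Finset.mem_insert_self _ _⟩
  · intro A hA
    exact Finset.insert_erase (Finset.mem_filter.1 hA).2
  · intro A hA
    exact Finset.erase_insert fun h => by simpa using Finset.mem_powerset.1 hA h
  · intro A hA
    have hxA := (Finset.mem_filter.1 hA).2
    have e : S \ A = S.erase x \ A.erase x := by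
      ext y
      simp only [Finset.mem_sdiff, Finset.mem_erase]
      refine ⟨fun h => ⟨⟨fun hy => h.2 (hy ▸ hxA), h.1⟩, fun h' => h.2 h'.2⟩,
        fun h => ⟨h.1.2, fun h' => h.2 ⟨h.1.1, h'⟩⟩⟩
    exact congrArg (fun U => Nat.stirlingSecond (Finset.card U) k) e

theorem sum_powerset_card_eq_one (S : Finset ℕ) (k : ℕ) :
    ∑ T ∈ S.powerset, (if T.card = 1 then Nat.stirlingSecond (S \ T).card k else 0)
      = S.card * Nat.stirlingSecond (S.card - 1) k := by
  rw [← Finset.sum_filter, ← Finset.powersetCard_eq_filter]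
  have h : ∀ T ∈ Finset.powersetCard 1 S, Nat.stirlingSecond (S \ T).card k
      = Nat.stirlingSecond (S.card - 1) k := by
    intro T hT
    rw [Finset.mem_powersetCard] at hT
    rw [Finset.card_sdiff_of_subset hT.1, hT.2]
  rw [Finset.sum_congr rfl h, Finset.sum_const, Finset.card_powersetCard, Nat.choose_one_right,
    smul_eq_mul]

theorem sum_powerset_card_eq_zero (S : Finset ℕ) (k : ℕ) :
    ∑ T ∈ S.powerset, (if T.card = 0 then Nat.stirlingSecond (S \ T).card k else 0)
      = Nat.stirlingSecond S.card k := by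
  simp [Finset.card_eq_zero]

theorem overlap_iff {A B : Finset ℕ} :
    Overlap A B ↔ ∃ a ∈ A, ∃ b ∈ B, ∃ c ∈ A, ∃ d ∈ B, (∀ x ∈ A, a ≤ x ∧ x ≤ c) ∧
      (∀ x ∈ B, b ≤ x ∧ x ≤ d) ∧ a < b ∧ b < c ∧ c < d := by
  constructor
  · rintro ⟨hA, hB, h⟩
    exact ⟨_, A.min'_mem hA, _, B.min'_mem hB, _, A.max'_mem hA, _, B.max'_mem hB,
      fun x hx => ⟨A.min'_le x hx, A.le_max' x hx⟩,
      fun x hx => ⟨B.min'_le x hx, B.le_max' x hx⟩, h⟩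
  · rintro ⟨a, ha, b, hb, c, hc, d, hd, hA, hB, h⟩
    have hAn : A.Nonempty := ⟨a, ha⟩
    have hBn : B.Nonempty := ⟨b, hb⟩
    have e1 : A.min' hAn = a := (A.min'_eq_iff hAn a).2 ⟨ha, fun x hx => (hA x hx).1⟩
    have e2 : B.min' hBn = b := (B.min'_eq_iff hBn b).2 ⟨hb, fun x hx => (hB x hx).1⟩
    have e3 : A.max' hAn = c := (A.max'_eq_iff hAn c).2 ⟨hc, fun x hx => (hA x hx).2⟩
    have e4 : B.max' hBn = d := (B.max'_eq_iff hBn d).2 ⟨hd, fun x hx => (hB x hx).2⟩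
    refine ⟨hAn, hBn, ?_⟩
    rw [e1, e2, e3, e4]
    exact h

/-- The number of ways to split `T` into an ordered pair of overlapping blocks. -/
noncomputable def overlapSplits (T : Finset ℕ) : ℕ :=
  (T.powerset.filter fun A => Overlap A (T \ A)).card

theorem card_le_one_overlapSplits {T : Finset ℕ} (hT : T.card ≤ 1) : overlapSplits T = 0 := by
  rw [overlapSplits, Finset.card_eq_zero, Finset.filter_eq_empty_iff]
  intro A hA h
  obtain ⟨a, ha, b, hb, c, hc, d, hd, -, -, h1, h2, h3⟩ := overlap_iff.1 h
  have hA := Finset.mem_powerset.1 hA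
  have := Finset.card_le_one.1 hT a (hA ha) c (hA hc)
  omega

theorem overlapSplits_add {T : Finset ℕ} (hT : 2 ≤ T.card) :
    overlapSplits T + (T.card - 1) = 2 ^ (T.card - 2) := by
  have hn : T.Nonempty := Finset.card_pos.1 (by omega)
  set a := T.min' hn with ha
  set b := T.max' hn with hb
  have haT : a ∈ T := T.min'_mem hn
  have hbT : b ∈ T := T.max'_mem hn
  have hmin : ∀ x ∈ T, a ≤ x := fun x hx => T.min'_le x hx
  have hmax : ∀ x ∈ T, x ≤ b := fun x hx => T.le_max' x hx
  have hab : a < b := by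
    refine lt_of_le_of_ne (hmin b hbT) fun e => ?_
    have : T.card ≤ 1 := Finset.card_le_one.2 fun x hx y hy => by
      have := hmin x hx; have := hmax x hx; have := hmin y hy; have := hmax y hy; omega
    omega
  have hinit : ((T.erase b).image fun t => T.filter fun x => x ≤ t).card = T.card - 1 := by
    rw [Finset.card_image_of_injOn, Finset.card_erase_of_mem hbT]
    intro s hs t ht hst
    have hs' := Finset.mem_of_mem_erase hs
    have ht' := Finset.mem_of_mem_erase ht
    simp only [Finset.ext_iff, Finset.mem_filter] at hst
    have h1 := (hst s).1 ⟨hs', le_rfl⟩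
    have h2 := (hst t).2 ⟨ht', le_rfl⟩
    omega
  have hall : (((T.erase a).erase b).powerset.image fun A => insert a A).card
      = 2 ^ (T.card - 2) := by
    rw [Finset.card_image_of_injOn, Finset.card_powerset, Finset.card_erase_of_mem,
      Finset.card_erase_of_mem haT, Nat.sub_sub]
    · exact Finset.mem_erase.2 ⟨hab.ne', hbT⟩
    · intro A hA B hB hAB
      have hA' : a ∉ A := fun h => by simpa using Finset.mem_powerset.1 hA h
      have hB' : a ∉ B := fun h => by simpa using Finset.mem_powerset.1 hB h
      rw [← Finset.erase_insert hA', ← Finset.erase_insert hB']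
      exact congrArg (fun C => Finset.erase C a) hAB
  have hmem : ∀ A, A ∈ (((T.erase a).erase b).powerset.image fun A => insert a A) ↔
      A ⊆ T ∧ a ∈ A ∧ b ∉ A := by
    intro A
    simp only [Finset.mem_image, Finset.mem_powerset]
    constructor
    · rintro ⟨C, hC, rfl⟩
      refine ⟨Finset.insert_subset haT fun x hx => ?_, Finset.mem_insert_self _ _, fun h => ?_⟩
      · have := hC hx
        simp only [Finset.mem_erase] at this
        exact this.2.2
      · rcases Finset.mem_insert.1 h with h | h
        · exact hab.ne' h
        · simpa using hC h
    · rintro ⟨hA, h1, h2⟩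
      refine ⟨A.erase a, fun x hx => ?_, Finset.insert_erase h1⟩
      simp only [Finset.mem_erase] at hx ⊢
      exact ⟨fun e => h2 (e ▸ hx.2), hx.1, hA hx.2⟩
  rw [overlapSplits, ← hinit, ← hall, ← Finset.card_union_of_disjoint]
  · congr 1
    ext A
    rw [hmem, Finset.mem_union, Finset.mem_filter, Finset.mem_powerset, Finset.mem_image,
      overlap_iff]
    constructor
    · rintro (⟨hA, p, hp, q, hq, r, hr, s, hs, hpr, hqs, h1, h2, h3⟩ | ⟨t, ht, rfl⟩)
      · refine ⟨hA, ?_, fun h => ?_⟩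
        · by_contra h
          have := (hqs a (Finset.mem_sdiff.2 ⟨haT, h⟩)).1
          have := hmin p (hA hp)
          omega
        · have := (hpr b h).2
          have := hmax s (Finset.mem_sdiff.1 hs).1
          omega
      · have ht := Finset.mem_erase.1 ht
        have := hmax t ht.2
        simp only [Finset.mem_filter, not_and, not_le]
        exact ⟨Finset.filter_subset _ _, ⟨haT, hmin t ht.2⟩, fun _ => lt_of_le_of_ne this ht.1⟩
    · rintro ⟨hA, haA, hbA⟩
      have hAn : A.Nonempty := ⟨a, haA⟩
      have hBn : (T \ A).Nonempty := ⟨b, Finset.mem_sdiff.2 ⟨hbT, hbA⟩⟩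
      have hc := A.max'_mem hAn
      have hq := Finset.mem_sdiff.1 ((T \ A).min'_mem hBn)
      by_cases h : (T \ A).min' hBn < A.max' hAn
      · refine Or.inl ⟨hA, a, haA, _, (T \ A).min'_mem hBn, _, hc, b,
          Finset.mem_sdiff.2 ⟨hbT, hbA⟩, fun x hx => ⟨hmin x (hA hx), A.le_max' x hx⟩,
          fun x hx => ⟨(T \ A).min'_le x hx, hmax x (Finset.mem_sdiff.1 hx).1⟩,
          lt_of_le_of_ne (hmin _ hq.1) fun e => hq.2 (e ▸ haA), h,
          lt_of_le_of_ne (hmax _ (hA hc)) fun e => hbA (e ▸ hc)⟩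
      · refine Or.inr ⟨A.max' hAn, Finset.mem_erase.2 ⟨fun e => hbA (e ▸ hc), hA hc⟩, ?_⟩
        ext x
        rw [Finset.mem_filter]
        refine ⟨fun hx => ?_, fun hx => ⟨hA hx, A.le_max' x hx⟩⟩
        by_contra hxA
        have h1 := (T \ A).min'_le x (Finset.mem_sdiff.2 ⟨hx.1, hxA⟩)
        have h2 : (T \ A).min' hBn = A.max' hAn := by omega
        exact hq.2 (h2 ▸ hc)
  · rw [Finset.disjoint_left]
    intro A hA hA'
    obtain ⟨-, hov⟩ := Finset.mem_filter.1 hA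
    obtain ⟨t, -, rfl⟩ := Finset.mem_image.1 hA'
    obtain ⟨p, hp, q, hq, r, hr, s, hs, -, -, h1, h2, h3⟩ := overlap_iff.1 hov
    simp only [Finset.mem_filter, Finset.mem_sdiff, not_and, not_le] at hr hq
    have := hq.2 hq.1
    omega

theorem four_mul_overlapSplits (T : Finset ℕ) :
    (4 * overlapSplits T : ℚ) = 2 ^ T.card - 4 * T.card + 4 - (if T.card = 1 then 2 else 0)
      - (if T.card = 0 then 5 else 0) := by
  by_cases hT : 2 ≤ T.card
  · have h := overlapSplits_add hT
    obtain ⟨m, hm⟩ := Nat.exists_eq_add_of_le' hT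
    rw [hm] at h ⊢
    have h' : (overlapSplits T : ℚ) + (m + 1) = 2 ^ m := by exact_mod_cast h
    rw [if_neg (by omega), if_neg (by omega)]
    push_cast
    rw [pow_add]
    linarith
  · rw [card_le_one_overlapSplits (by omega)]
    obtain h | h : T.card = 0 ∨ T.card = 1 := by omega
    all_goals rw [h]; norm_num

theorem ov_eq_sum (P : Finset (Finset ℕ)) :
    ov P = ∑ A ∈ P, ∑ B ∈ P.erase A, if Overlap A B then 1 else 0 := by
  have h : ov P = ((P ×ˢ P).filter fun p => Overlap p.1 p.2).card := by
    rw [ov]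
    exact Nat.subtype_card _ fun p => by simp [and_assoc]
  rw [h, Finset.card_filter, Finset.sum_product]
  refine Finset.sum_congr rfl fun A hA => ?_
  rw [← Finset.add_sum_erase P _ hA, if_neg, zero_add]
  rintro ⟨h, h', h1, -⟩
  exact lt_irrefl _ h1

theorem sum_ov_blockPartitions (S : Finset ℕ) (k : ℕ) :
    ∑ P ∈ blockPartitions S (k + 2), ov P
      = ∑ T ∈ S.powerset, overlapSplits T * Nat.stirlingSecond (S \ T).card k := by
  have hne : ∀ A B, Overlap A B → A ≠ ∅ ∧ B ≠ ∅ := fun A B ⟨hA, hB, _⟩ => ⟨hA.ne_empty, hB.ne_empty⟩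
  have h0 : ∀ (U : Finset ℕ) (f : Finset ℕ → ℕ), f ∅ = 0 →
      ∑ A ∈ U.powerset.erase ∅, f A = ∑ A ∈ U.powerset, f A :=
    fun U f hf => Finset.sum_erase _ hf
  simp only [ov_eq_sum]
  rw [sum_blockPartitions_marked S (k + 1) fun A Q => ∑ B ∈ Q, if Overlap A B then 1 else 0]
  simp only [sum_blockPartitions_weight, card_blockPartitions]
  rw [h0]
  · have : ∀ A ∈ S.powerset, ∑ B ∈ (S \ A).powerset.erase ∅,
        (if Overlap A B then 1 else 0) * Nat.stirlingSecond ((S \ A) \ B).card k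
        = ∑ B ∈ (S \ A).powerset,
          (if Overlap A B then 1 else 0) * Nat.stirlingSecond (S \ (A ∪ B)).card k := by
      intro A _
      rw [h0]
      · refine Finset.sum_congr rfl fun B _ => ?_
        rw [Finset.sdiff_sdiff_left', Finset.sdiff_union_distrib]
      · rw [if_neg fun h => (hne _ _ h).2 rfl, zero_mul]
    rw [Finset.sum_congr rfl this, sum_powerset_sdiff S fun A B =>
      (if Overlap A B then 1 else 0) * Nat.stirlingSecond (S \ (A ∪ B)).card k]
    refine Finset.sum_congr rfl fun T _ => ?_
    rw [overlapSplits, Finset.card_filter, Finset.sum_mul]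
    refine Finset.sum_congr rfl fun A hA => ?_
    rw [Finset.union_sdiff_of_subset (Finset.mem_powerset.1 hA)]
  · refine Finset.sum_eq_zero fun B _ => ?_
    rw [if_neg fun h => (hne _ _ h).1 rfl, zero_mul]

theorem four_mul_sum_ov_blockPartitions (S : Finset ℕ) (k : ℕ) :
    4 * ∑ P ∈ blockPartitions S (k + 2), (ov P : ℚ)
      = (k + 1) * Nat.stirlingSecond (S.card + 1) (k + 2)
        + 5 * Nat.stirlingSecond (S.card + 1) (k + 1)
        - 4 * (S.card * Nat.stirlingSecond S.card (k + 1))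
        - 2 * (S.card * Nat.stirlingSecond (S.card - 1) k)
        - 5 * Nat.stirlingSecond S.card k := by
  have h := congrArg (Nat.cast : ℕ → ℚ) (sum_ov_blockPartitions S k)
  have h1 := congrArg (Nat.cast : ℕ → ℚ) (sum_powerset_two_pow_mul_stirlingSecond S k)
  have h2 := congrArg (Nat.cast : ℕ → ℚ) (sum_powerset_stirlingSecond S k)
  have h3 := congrArg (Nat.cast : ℕ → ℚ) (sum_powerset_card_mul_stirlingSecond S k)
  have h4 := congrArg (Nat.cast : ℕ → ℚ) (sum_powerset_card_eq_one S k)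
  have h5 := congrArg (Nat.cast : ℕ → ℚ) (sum_powerset_card_eq_zero S k)
  push_cast at h h1 h2 h3 h4 h5
  have hs : 4 * ∑ T ∈ S.powerset, (overlapSplits T : ℚ) * Nat.stirlingSecond (S \ T).card k
      = ∑ T ∈ S.powerset, (2 : ℚ) ^ T.card * Nat.stirlingSecond (S \ T).card k
        + 4 * ∑ T ∈ S.powerset, (Nat.stirlingSecond (S \ T).card k : ℚ)
        - 4 * ∑ T ∈ S.powerset, (T.card : ℚ) * Nat.stirlingSecond (S \ T).card k
        - 2 * ∑ T ∈ S.powerset,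
          (if T.card = 1 then (Nat.stirlingSecond (S \ T).card k : ℚ) else 0)
        - 5 * ∑ T ∈ S.powerset,
          (if T.card = 0 then (Nat.stirlingSecond (S \ T).card k : ℚ) else 0) := by
    simp only [Finset.mul_sum, ← Finset.sum_add_distrib, ← Finset.sum_sub_distrib]
    refine Finset.sum_congr rfl fun T _ => ?_
    rw [← mul_assoc, four_mul_overlapSplits]
    split_ifs <;> ring
  rw [h, hs, h1, h2, h3, h4, h5]
  ring

theorem ov_eq_zero_of_card_eq_one {P : Finset (Finset ℕ)} (hP : P.card = 1) : ov P = 0 := by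
  obtain ⟨A, rfl⟩ := Finset.card_eq_one.1 hP
  simp [ov_eq_sum]

/-- exact total and average number of overlappings over `Π_n^k`. -/
theorem ov_mean_over_partitionsK (n k : ℕ) (hk : 1 ≤ k) (hkn : k ≤ n) :
    (∑ π ∈ partitionsK n k, (ov π : ℚ))
        = ((k : ℚ) * ((k : ℚ) - 1) / 4) * (stirling n k : ℚ)
            - (3/2) * ((n : ℚ) + 1 - (k : ℚ)) * (stirling n (k-1) : ℚ)
            + ((n : ℚ) * ((k : ℚ) - 1) / 2) * (stirling (n-1) (k-1) : ℚ) ∧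
    (∑ π ∈ partitionsK n k, (ov π : ℚ)) / (stirling n k : ℚ)
        = (((k : ℚ) * ((k : ℚ) - 1) / 4) * (stirling n k : ℚ)
            - (3/2) * ((n : ℚ) + 1 - (k : ℚ)) * (stirling n (k-1) : ℚ)
            + ((n : ℚ) * ((k : ℚ) - 1) / 2) * (stirling (n-1) (k-1) : ℚ)) / (stirling n k : ℚ) := by
  refine (fun h => ⟨h, congrArg (· / (stirling n k : ℚ)) h⟩) ?_
  obtain ⟨m, rfl⟩ := Nat.exists_eq_add_of_le' (hk.trans hkn)
  simp only [stirling_eq_stirlingSecond, partitionsK_eq_blockPartitions]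
  obtain rfl | hk2 := hk.eq_or_lt
  · rw [Finset.sum_eq_zero fun P hP => by
      rw [ov_eq_zero_of_card_eq_one (mem_blockPartitions.1 hP).2, Nat.cast_zero]]
    simp
  obtain ⟨j, rfl⟩ := Nat.exists_eq_add_of_le' hk2
  have h := four_mul_sum_ov_blockPartitions (seg (m + 1)) j
  have hc : (seg (m + 1)).card = m + 1 := by simp [seg]
  have e1 : j + 2 - 1 = j + 1 := rfl
  rw [hc] at h
  simp only [Nat.add_sub_cancel, e1] at h ⊢
  rw [Nat.stirlingSecond_succ_succ (m + 1) (j + 1), Nat.stirlingSecond_succ_succ (m + 1) j] at h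
  have hr := congrArg (Nat.cast : ℕ → ℚ) (Nat.stirlingSecond_succ_succ m j)
  push_cast at h hr ⊢
  linear_combination h / 4 + (m + 1 : ℚ) / 2 * hr
end
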